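/- arXiv:math/9605201 — 2 statements merged into one kernel-verified Lean document; each statement's English description precedes it below -/
import Mathlib

section
/- Let A be a group and let C be a normal subgroup of A. Then the HNN extension A*_C = ⟨A, s | s⁻¹cs = c for all c ∈ C⟩ embeds in the direct product D' = (A/C * ⟨s⟩) × A of A with the free product of the quotient A/C with an infinite cyclic group ⟨s⟩; that is, there exists an injective group homomorphism from A*_C into D'. -/
/-- Let `A` be a group and `C` a normal subgroup of `A`. Then the HNN extension
`A*_C = ⟨A, s | s⁻¹cs = c, ∀ c ∈ C⟩` (the HNN extension with both associated subgroups `C` and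
associating isomorphism the identity) embeds in the direct product `D' = (A/C * ⟨s⟩) × A`, where
`⟨s⟩` is an infinite cyclic group. -/
theorem hnn_embeds_in_free_product_times_base
    (A : Type*) [Group A] (C : Subgroup A) [C.Normal] :
    ∃ f : HNNExtension A C C (MulEquiv.refl C) →*
        (Monoid.Coprod (A ⧸ C) (Multiplicative ℤ)) × A,
      Function.Injective f := by
  classical
  let H := HNNExtension A C C (MulEquiv.refl C)
  let f₁ : H →* Monoid.Coprod (A ⧸ C) (Multiplicative ℤ) :=
    HNNExtension.lift (Monoid.Coprod.inl.comp (QuotientGroup.mk' C))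
      (Monoid.Coprod.inr (Multiplicative.ofAdd 1)) (by
        intro a
        have h : QuotientGroup.mk' C (a : A) = 1 := by simp
        simp only [MonoidHom.comp_apply, MulEquiv.refl_apply, h, map_one, mul_one, one_mul])
  let f₂ : H →* A := HNNExtension.lift (MonoidHom.id A) 1 (by intro a; simp)
  -- the image of `C` in the HNN extension, a normal subgroup
  let N : Subgroup H := C.map HNNExtension.of
  have hN : N.Normal := by
    rw [← Subgroup.normalizer_eq_top_iff, eq_top_iff]
    intro x _
    induction x using HNNExtension.induction_on with
    | of g =>
      have hle := Subgroup.le_normalizer_map (H := C)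
        (HNNExtension.of : A →* HNNExtension A C C (MulEquiv.refl C))
      apply hle
      rw [Subgroup.normalizer_eq_top]
      exact ⟨g, trivial, rfl⟩
    | t =>
      apply Subgroup.centralizer_le_normalizer
      rw [Subgroup.mem_centralizer_iff]
      rintro _ ⟨c, hc, rfl⟩
      exact (HNNExtension.t_mul_of (φ := MulEquiv.refl C) ⟨c, hc⟩).symm
    | mul x y hx hy => exact mul_mem (hx trivial) (hy trivial)
    | inv x hx => exact inv_mem (hx trivial)
  let g : Monoid.Coprod (A ⧸ C) (Multiplicative ℤ) →* H ⧸ N :=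
    Monoid.Coprod.lift
      (QuotientGroup.lift C ((QuotientGroup.mk' N).comp HNNExtension.of) (by
        intro c hc
        exact (QuotientGroup.eq_one_iff _).2 ⟨c, hc, rfl⟩))
      (zpowersHom _ (QuotientGroup.mk' N HNNExtension.t))
  have hg : g.comp f₁ = QuotientGroup.mk' N := by
    apply HNNExtension.hom_ext
    · ext a
      simp [g, f₁]
      rfl
    · simp [g, f₁]
  refine ⟨f₁.prod f₂, (injective_iff_map_eq_one _).2 ?_⟩
  intro x hx
  have h1 : f₁ x = 1 := congrArg Prod.fst hx
  have h2 : f₂ x = 1 := congrArg Prod.snd hx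
  have hxN : x ∈ N := by
    rw [← QuotientGroup.eq_one_iff]
    have := DFunLike.congr_fun hg x
    rw [MonoidHom.comp_apply, h1, map_one] at this
    exact this.symm
  obtain ⟨c, hc, rfl⟩ := hxN
  have : c = 1 := (HNNExtension.lift_of (φ := MulEquiv.refl C) (MonoidHom.id A) 1 _ c).symm.trans h2
  rw [this, map_one]
end

section
/- Let C be a normal subgroup of the finitely presented group A such that C is the normal closure in A of a finite subset. Let a₁, …, a_m be elements of A whose images in A/C generate A/C, let F_m be the free group with basis t₁, …, t_m, and let F_m act on the double G = {A * Ā ; C = C̄} of A along C by letting each tᵢ act on the copy A as conjugation by aᵢ and on the copy Ā as conjugation by āᵢ. Then the split extension E = G ⋊ F_m is finitely presented, and E embeds in the finitely presented group D = ((A/C * Ā/C̄) ⋊ F_m) × A, the direct product of A with the split extension of the free product of two copies of A/C by F_m, where each tᵢ acts on each free factor A/C as conjugation by the image of aᵢ. -/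
/-- A group is finitely presented if it is isomorphic to the quotient of a finitely generated
free group by the normal closure of a finite set of relators. -/
def IsFinitelyPresentedGroup (G : Type*) [Group G] : Prop :=
  ∃ (n : ℕ) (R : Finset (FreeGroup (Fin n))),
    Nonempty ((FreeGroup (Fin n) ⧸
      Subgroup.normalClosure (R : Set (FreeGroup (Fin n)))) ≃* G)

theorem isFinitelyPresentedGroup_iff (G : Type*) [Group G] :
    IsFinitelyPresentedGroup G ↔ Group.IsFinitelyPresented G := by
  constructor
  · rintro ⟨n, R, ⟨e⟩⟩
    have : Group.IsFinitelyPresented (FreeGroup (Fin n) ⧸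
      Subgroup.normalClosure (R : Set (FreeGroup (Fin n)))) :=
      Group.IsFinitelyPresented.quotient _ ⟨R, R.finite_toSet, rfl⟩
    exact Group.IsFinitelyPresented.equiv e
  · intro h
    obtain ⟨n, s, hs, ⟨e⟩⟩ := Group.IsFinitelyPresented.exists_mulEquiv_presentedGroup (G := G)
    obtain ⟨R, rfl⟩ := hs.exists_finset_coe
    exact ⟨n, R, ⟨e.symm⟩⟩

theorem fp_exists_gens (G : Type*) [Group G] [h : Group.IsFinitelyPresented G] :
    ∃ X : Set G, X.Finite ∧ Subgroup.closure X = ⊤ := by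
  obtain ⟨n, φ, hφ, -⟩ := h.out
  refine ⟨φ '' Set.range FreeGroup.of, (Set.finite_range _).image _, ?_⟩
  rw [← MonoidHom.map_closure, FreeGroup.closure_range_of, ← MonoidHom.range_eq_map,
    MonoidHom.range_eq_top]
  exact hφ

/-- Recognition of a finitely presented quotient. -/
theorem fp_crit {P Q : Type*} [Group P] [Group Q] [Group.IsFinitelyPresented P]
    (π : P →* Q) (hπ : Function.Surjective π) (R : Set P) (hRf : R.Finite)
    (hR : ∀ r ∈ R, π r = 1) (j : Q →* P ⧸ Subgroup.normalClosure R)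
    (hj : j.comp π = QuotientGroup.mk' _) : Group.IsFinitelyPresented Q := by
  refine Group.IsFinitelyPresented.of_surjective π hπ ⟨R, hRf, le_antisymm ?_ ?_⟩
  · exact Subgroup.normalClosure_le_normal (fun r hr => hR r hr)
  · intro x hx
    have h1 : (QuotientGroup.mk' (Subgroup.normalClosure R)) x = 1 := by
      rw [← hj, MonoidHom.comp_apply, MonoidHom.mem_ker.1 hx, map_one]
    rwa [QuotientGroup.mk'_apply, QuotientGroup.eq_one_iff] at h1

/-- To check a compatibility of homomorphisms with an action it suffices to do so on generators. -/
theorem action_compat {G K Q : Type*} [Group G] [Group K] [Group Q]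
    (φ : K →* MulAut G) (u : G →* Q) (v : K →* Q) (X : Set G) (hX : Subgroup.closure X = ⊤)
    (Y : Set K) (hY : Subgroup.closure Y = ⊤)
    (h : ∀ y ∈ Y, ∀ x ∈ X, u (φ y x) = v y * u x * (v y)⁻¹) (k : K) :
    u.comp (φ k).toMonoidHom = (MulAut.conj (v k)).toMonoidHom.comp u := by
  have hk : k ∈ Subgroup.closure Y := by rw [hY]; trivial
  induction hk using Subgroup.closure_induction with
  | mem y hy =>
    refine MonoidHom.eq_of_eqOn_dense hX ?_
    intro x hx
    simpa using h y hy x hx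
  | one => ext; simp
  | mul a b _ _ ha hb =>
    ext g
    have h1 := DFunLike.congr_fun ha (φ b g)
    have h2 := DFunLike.congr_fun hb g
    simp at h1 h2 ⊢
    rw [h1, h2]
  | inv a _ ha =>
    ext g
    have h1 := DFunLike.congr_fun ha (φ a⁻¹ g)
    simp at h1 ⊢
    rw [h1]; simp [mul_assoc]

/-- Split extensions of finitely presented groups by finitely presented groups. -/
theorem fp_semidirect {G K : Type*} [Group G] [Group K] [Group.IsFinitelyPresented G]
    [Group.IsFinitelyPresented K] (φ : K →* MulAut G) :
    Group.IsFinitelyPresented (G ⋊[φ] K) := by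
  obtain ⟨X, hXf, hX⟩ := fp_exists_gens G
  obtain ⟨Y, hYf, hY⟩ := fp_exists_gens K
  let rel : G × K → Monoid.Coprod G K := fun p =>
    Monoid.Coprod.inr p.2 * Monoid.Coprod.inl p.1 * (Monoid.Coprod.inr p.2)⁻¹ *
      (Monoid.Coprod.inl (φ p.2 p.1))⁻¹
  let R : Set (Monoid.Coprod G K) := rel '' (X ×ˢ Y)
  let q := QuotientGroup.mk' (Subgroup.normalClosure R)
  refine fp_crit (Monoid.Coprod.lift SemidirectProduct.inl SemidirectProduct.inr) ?_ R
    ((hXf.prod hYf).image _) ?_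
    (SemidirectProduct.lift (q.comp Monoid.Coprod.inl) (q.comp Monoid.Coprod.inr)
      (action_compat φ _ _ X hX Y hY ?_)) ?_
  · intro x
    refine ⟨Monoid.Coprod.inl x.left * Monoid.Coprod.inr x.right, ?_⟩
    simp
  · rintro _ ⟨⟨g, k⟩, -, rfl⟩
    simp [rel, SemidirectProduct.inl_aut]
  · intro y hy x hx
    have h1 : q (rel (x, y)) = 1 := by
      rw [QuotientGroup.mk'_apply, QuotientGroup.eq_one_iff]
      exact Subgroup.subset_normalClosure ⟨(x, y), ⟨hx, hy⟩, rfl⟩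
    simp only [rel, map_mul, map_inv] at h1
    exact (mul_inv_eq_one.1 h1).symm
  · ext x <;> simp [q]

theorem fp_prod {G K : Type*} [Group G] [Group K] [Group.IsFinitelyPresented G]
    [Group.IsFinitelyPresented K] : Group.IsFinitelyPresented (G × K) := by
  have := fp_semidirect (1 : K →* MulAut G)
  exact Group.IsFinitelyPresented.equiv SemidirectProduct.mulEquivProd

/-- Enlarging a finite normal generating set. -/
theorem exists_good_gens (A : Type*) [Group A] [Group.IsFinitelyPresented A] (C : Subgroup A)
    [C.Normal] (hC : ∃ S : Finset A, Subgroup.normalClosure (S : Set A) = C)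
    (m : ℕ) (a : Fin m → A)
    (ha : Subgroup.closure (Set.range fun i => (QuotientGroup.mk (a i) : A ⧸ C)) = ⊤) :
    ∃ S : Set A, S.Finite ∧ Subgroup.normalClosure S = C ∧
      Subgroup.closure (S ∪ Set.range a) = ⊤ := by
  obtain ⟨S₀, hS₀⟩ := hC
  obtain ⟨X, hXf, hX⟩ := fp_exists_gens A
  have hw : ∀ x : A, ∃ w ∈ Subgroup.closure (Set.range a), w⁻¹ * x ∈ C := by
    intro x
    have h1 : (QuotientGroup.mk' C x) ∈ (Subgroup.closure (Set.range a)).map (QuotientGroup.mk' C) := by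
      rw [MonoidHom.map_closure, ← Set.range_comp]
      have : (QuotientGroup.mk' C) ∘ a = fun i => (QuotientGroup.mk (a i) : A ⧸ C) := rfl
      rw [this, ha]; trivial
    obtain ⟨w, hw, hwx⟩ := h1
    exact ⟨w, hw, QuotientGroup.eq.1 hwx⟩
  choose w hw hwC using hw
  have hsub : ((fun x => (w x)⁻¹ * x) '' X) ⊆ C := by
    rintro _ ⟨x, -, rfl⟩
    exact hwC x
  refine ⟨S₀ ∪ (fun x => (w x)⁻¹ * x) '' X, S₀.finite_toSet.union (hXf.image _), ?_, ?_⟩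
  · refine le_antisymm (Subgroup.normalClosure_le_normal (Set.union_subset ?_ hsub)) ?_
    · rw [← hS₀]; exact Subgroup.subset_normalClosure
    · conv_lhs => rw [← hS₀]
      exact Subgroup.normalClosure_mono Set.subset_union_left
  · rw [eq_top_iff, ← hX, Subgroup.closure_le]
    intro x hx
    have h1 : w x * ((w x)⁻¹ * x) = x := by group
    rw [← h1]
    refine mul_mem (Subgroup.closure_mono Set.subset_union_right (hw x)) ?_
    exact Subgroup.subset_closure (Or.inl (Or.inr ⟨x, hx, rfl⟩))

/-- If `u, v` agree on `S` and are compatible with conjugation by the `aᵢ`, they agree on the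
normal closure of `S`. -/
theorem agree_on_normalClosure {A Q : Type*} [Group A] [Group Q] (S : Set A) (m : ℕ)
    (a : Fin m → A) (hgen : Subgroup.closure (S ∪ Set.range a) = ⊤) (u v : A →* Q)
    (t : Fin m → Q) (hS : ∀ s ∈ S, u s = v s)
    (hu : ∀ i x, u ((a i)⁻¹ * x * a i) = t i * u x * (t i)⁻¹)
    (hv : ∀ i x, v ((a i)⁻¹ * x * a i) = t i * v x * (t i)⁻¹) :
    ∀ x ∈ Subgroup.normalClosure S, u x = v x := by
  have hN : (MonoidHom.eqLocus u v).Normal := by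
    rw [← Subgroup.normalizer_eq_top_iff, eq_top_iff, ← hgen, Subgroup.closure_le]
    rintro g (hg | ⟨i, rfl⟩)
    · exact Subgroup.le_normalizer (hS g hg)
    · rw [SetLike.mem_coe, Subgroup.mem_normalizer_iff'']
      intro x
      change u x = v x ↔ u _ = v _
      rw [hu, hv]
      simp
  intro x hx
  exact Subgroup.normalClosure_le_normal (N := MonoidHom.eqLocus u v) (fun s hs => hS s hs) hx

section main
variable {A : Type*} [Group A] (C : Subgroup A) [C.Normal] {m : ℕ} (a : Fin m → A)


theorem dbl_closure : Subgroup.closure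
    (Set.range (Monoid.PushoutI.of (φ := fun _ : Bool => C.subtype) true) ∪
     Set.range (Monoid.PushoutI.of (φ := fun _ : Bool => C.subtype) false)) = ⊤ := by
  rw [eq_top_iff]
  intro x _
  induction x using Monoid.PushoutI.induction_on with
  | of i g =>
    apply Subgroup.subset_closure
    cases i
    · exact Or.inr ⟨g, rfl⟩
    · exact Or.inl ⟨g, rfl⟩
  | base c =>
    rw [← Monoid.PushoutI.of_apply_eq_base (fun _ : Bool => C.subtype) true c]
    exact Subgroup.subset_closure (Or.inl ⟨_, rfl⟩)
  | mul x y hx hy => exact mul_mem (hx trivial) (hy trivial)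

theorem coprod_closure (G H : Type*) [Group G] [Group H] : Subgroup.closure
    (Set.range (Monoid.Coprod.inl : G →* Monoid.Coprod G H) ∪
     Set.range (Monoid.Coprod.inr : H →* Monoid.Coprod G H)) = ⊤ := by
  exact Monoid.Coprod.closure_range_inl_union_inr

theorem fp_E [Group.IsFinitelyPresented A]
    (hC : ∃ S : Finset A, Subgroup.normalClosure (S : Set A) = C)
    (ha : Subgroup.closure (Set.range fun i => (QuotientGroup.mk (a i) : A ⧸ C)) = ⊤)
    (ρ : FreeGroup (Fin m) →* MulAut (Monoid.PushoutI (fun _ : Bool => C.subtype)))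
    (hρ : ∀ (i : Fin m) (b : Bool) (x : A),
      ρ (FreeGroup.of i) (Monoid.PushoutI.of (φ := fun _ : Bool => C.subtype) b x) =
        Monoid.PushoutI.of (φ := fun _ : Bool => C.subtype) b ((a i)⁻¹ * x * a i)) :
    Group.IsFinitelyPresented ((Monoid.PushoutI (fun _ : Bool => C.subtype)) ⋊[ρ] FreeGroup (Fin m)) := by
  obtain ⟨S, hSf, hSC, hgen⟩ := exists_good_gens A C hC m a ha
  let τ : FreeGroup (Fin m) →* MulAut (Monoid.Coprod A A) := FreeGroup.lift fun i =>
    MulEquiv.coprodCongr (MulAut.conj (a i)⁻¹) (MulAut.conj (a i)⁻¹)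
  have hτl : ∀ i x, τ (FreeGroup.of i) (Monoid.Coprod.inl x) =
      Monoid.Coprod.inl ((a i)⁻¹ * x * a i) := by
    intro i x; simp [τ, MulEquiv.coprodCongr]
  have hτr : ∀ i x, τ (FreeGroup.of i) (Monoid.Coprod.inr x) =
      Monoid.Coprod.inr ((a i)⁻¹ * x * a i) := by
    intro i x; simp [τ, MulEquiv.coprodCongr]
  have := fp_semidirect τ
  let rel : A → Monoid.Coprod A A ⋊[τ] FreeGroup (Fin m) := fun s =>
    SemidirectProduct.inl (Monoid.Coprod.inl s * (Monoid.Coprod.inr s)⁻¹)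
  let R := rel '' S
  let q := QuotientGroup.mk' (Subgroup.normalClosure R)
  let o := fun b => Monoid.PushoutI.of (φ := fun _ : Bool => C.subtype) b
  let p : Monoid.Coprod A A →* (Monoid.PushoutI (fun _ : Bool => C.subtype)) := Monoid.Coprod.lift (o true) (o false)
  have hp : Function.Surjective p := by
    rw [← MonoidHom.range_eq_top, eq_top_iff, ← dbl_closure C, Subgroup.closure_le]
    rintro _ (⟨x, rfl⟩ | ⟨x, rfl⟩)
    · exact ⟨Monoid.Coprod.inl x, by simp [p, o]⟩
    · exact ⟨Monoid.Coprod.inr x, by simp [p, o]⟩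
  let u : A →* _ := (q.comp SemidirectProduct.inl).comp Monoid.Coprod.inl
  let v : A →* _ := (q.comp SemidirectProduct.inl).comp Monoid.Coprod.inr
  let t : FreeGroup (Fin m) →* _ := q.comp SemidirectProduct.inr
  have hu : ∀ i x, u ((a i)⁻¹ * x * a i) =
      t (FreeGroup.of i) * u x * (t (FreeGroup.of i))⁻¹ := by
    intro i x
    simp only [u, t, MonoidHom.comp_apply]
    rw [← hτl, SemidirectProduct.inl_aut]
    simp only [map_mul, map_inv]
  have hv : ∀ i x, v ((a i)⁻¹ * x * a i) =
      t (FreeGroup.of i) * v x * (t (FreeGroup.of i))⁻¹ := by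
    intro i x
    simp only [v, t, MonoidHom.comp_apply]
    rw [← hτr, SemidirectProduct.inl_aut]
    simp only [map_mul, map_inv]
  have hag : ∀ x ∈ C, u x = v x := by
    rw [← hSC]
    refine agree_on_normalClosure S m a hgen u v (fun i => t (FreeGroup.of i)) ?_ hu hv
    intro s hs
    have h1 : q (rel s) = 1 := by
      rw [QuotientGroup.mk'_apply, QuotientGroup.eq_one_iff]
      exact Subgroup.subset_normalClosure ⟨s, hs, rfl⟩
    simp only [rel, map_mul, map_inv] at h1
    exact mul_inv_eq_one.1 h1
  let uv : (Monoid.PushoutI (fun _ : Bool => C.subtype)) →* _ := Monoid.PushoutI.lift (fun b => cond b u v) (u.comp C.subtype) (by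
    intro b
    cases b
    · ext c; exact (hag c c.2).symm
    · rfl)
  have huv1 : ∀ x, uv (o true x) = u x := fun x => by simp [uv, o]
  have huv2 : ∀ x, uv (o false x) = v x := fun x => by simp [uv, o]
  refine fp_crit (SemidirectProduct.map p (MonoidHom.id _) ?_) ?_ R (hSf.image _) ?_
    (SemidirectProduct.lift uv t (action_compat ρ uv t _ (dbl_closure C) _
      (FreeGroup.closure_range_of _) ?_)) ?_
  · intro g
    have := action_compat τ (SemidirectProduct.inl.comp p : _ →* (Monoid.PushoutI (fun _ : Bool => C.subtype)) ⋊[ρ] FreeGroup (Fin m))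
      SemidirectProduct.inr _ (coprod_closure A A) _ (FreeGroup.closure_range_of _) (by
        rintro _ ⟨i, rfl⟩ _ (⟨x, rfl⟩ | ⟨x, rfl⟩)
        · simp only [MonoidHom.comp_apply]
          rw [← map_inv, ← SemidirectProduct.inl_aut, hτl]
          simp [p, o, hρ]
        · simp only [MonoidHom.comp_apply]
          rw [← map_inv, ← SemidirectProduct.inl_aut, hτr]
          simp [p, o, hρ]) g
    refine MonoidHom.ext fun x => ?_
    have h2 := DFunLike.congr_fun this x
    apply SemidirectProduct.inl_injective (φ := ρ)
    refine h2.trans ?_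
    simp [SemidirectProduct.inl_aut]
  · rintro ⟨x, k⟩
    obtain ⟨y, rfl⟩ := hp x
    exact ⟨⟨y, k⟩, rfl⟩
  · rintro _ ⟨s, hs, rfl⟩
    have hsC : s ∈ C := hSC ▸ Subgroup.subset_normalClosure hs
    have : o true s = o false s :=
      (Monoid.PushoutI.of_apply_eq_base (fun _ : Bool => C.subtype) true ⟨s, hsC⟩).trans
      (Monoid.PushoutI.of_apply_eq_base (fun _ : Bool => C.subtype) false ⟨s, hsC⟩).symm
    simp [rel, p, this]
  · rintro _ ⟨i, rfl⟩ _ (⟨x, rfl⟩ | ⟨x, rfl⟩)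
    · rw [hρ]
      exact (huv1 _).trans ((hu i x).trans (by rw [← huv1 x]))
    · rw [hρ]
      exact (huv2 _).trans ((hv i x).trans (by rw [← huv2 x]))
  · refine SemidirectProduct.hom_ext (Monoid.Coprod.hom_ext ?_ ?_) ?_
    · ext x
      simp only [MonoidHom.comp_apply, SemidirectProduct.map_inl, SemidirectProduct.lift_inl]
      exact huv1 x
    · ext x
      simp only [MonoidHom.comp_apply, SemidirectProduct.map_inl, SemidirectProduct.lift_inl]
      exact huv2 x
    · ext x
      simp only [MonoidHom.comp_apply, SemidirectProduct.map_inr, SemidirectProduct.lift_inr]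
      rfl

theorem embeds_E
    (ρ : FreeGroup (Fin m) →* MulAut (Monoid.PushoutI (fun _ : Bool => C.subtype)))
    (hρ : ∀ (i : Fin m) (b : Bool) (x : A),
      ρ (FreeGroup.of i) (Monoid.PushoutI.of (φ := fun _ : Bool => C.subtype) b x) =
        Monoid.PushoutI.of (φ := fun _ : Bool => C.subtype) b ((a i)⁻¹ * x * a i))
    (σ : FreeGroup (Fin m) →* MulAut (Monoid.Coprod (A ⧸ C) (A ⧸ C)))
    (hσl : ∀ (i : Fin m) (q : A ⧸ C), σ (FreeGroup.of i) (Monoid.Coprod.inl q) =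
      Monoid.Coprod.inl ((QuotientGroup.mk (a i) : A ⧸ C)⁻¹ * q * QuotientGroup.mk (a i)))
    (hσr : ∀ (i : Fin m) (q : A ⧸ C), σ (FreeGroup.of i) (Monoid.Coprod.inr q) =
      Monoid.Coprod.inr ((QuotientGroup.mk (a i) : A ⧸ C)⁻¹ * q * QuotientGroup.mk (a i))) :
    ∃ f : ((Monoid.PushoutI (fun _ : Bool => C.subtype)) ⋊[ρ] FreeGroup (Fin m)) →*
        ((Monoid.Coprod (A ⧸ C) (A ⧸ C)) ⋊[σ] FreeGroup (Fin m)) × A,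
      Function.Injective f := by
  let o := fun b => Monoid.PushoutI.of (φ := fun _ : Bool => C.subtype) b
  let B : C →* (Monoid.PushoutI (fun _ : Bool => C.subtype)) := Monoid.PushoutI.base (fun _ : Bool => C.subtype)
  have hoB : ∀ b (c : C), o b (c : A) = B c := fun b c =>
    Monoid.PushoutI.of_apply_eq_base (fun _ : Bool => C.subtype) b c
  let mkC := QuotientGroup.mk' C
  have hmk : ∀ c : C, mkC (c : A) = 1 := fun c => (QuotientGroup.eq_one_iff _).2 c.2
  -- the two projections of the double
  let fold : (Monoid.PushoutI (fun _ : Bool => C.subtype)) →* A := Monoid.PushoutI.lift (fun _ => MonoidHom.id A) C.subtype (fun _ => rfl)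
  have hfold : ∀ b x, fold (o b x) = x := fun b x => by simp [fold, o]
  let κ : (Monoid.PushoutI (fun _ : Bool => C.subtype)) →* Monoid.Coprod (A ⧸ C) (A ⧸ C) := Monoid.PushoutI.lift
    (fun b => cond b (Monoid.Coprod.inl.comp mkC) (Monoid.Coprod.inr.comp mkC)) 1 (by
      intro b
      cases b
      · ext c
        change Monoid.Coprod.inr (mkC c) = 1
        rw [hmk, map_one]
      · ext c
        change Monoid.Coprod.inl (mkC c) = 1
        rw [hmk, map_one])
  have hκ1 : ∀ x, κ (o true x) = Monoid.Coprod.inl (mkC x) := fun x => by simp [κ, o]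
  have hκ2 : ∀ x, κ (o false x) = Monoid.Coprod.inr (mkC x) := fun x => by simp [κ, o]
  -- the kernel of `κ`
  have hBn : B.range.Normal := by
    rw [← Subgroup.normalizer_eq_top_iff, eq_top_iff, ← dbl_closure C, Subgroup.closure_le]
    have key : ∀ b x, o b x ∈ Subgroup.normalizer (B.range : Set (Monoid.PushoutI (fun _ : Bool => C.subtype))) := by
      intro b x
      have h1 : ∀ y : A, ∀ h ∈ B.range, o b y * h * (o b y)⁻¹ ∈ B.range := by
        rintro y _ ⟨c, rfl⟩
        refine ⟨⟨y * c * y⁻¹, Subgroup.Normal.conj_mem inferInstance _ c.2 y⟩, ?_⟩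
        rw [← hoB b, ← hoB b]
        simp
      rw [Subgroup.mem_normalizer_iff]
      intro h
      refine ⟨h1 x h, fun hh => ?_⟩
      have := h1 x⁻¹ _ hh
      convert this using 1
      rw [map_inv]; group
    rintro _ (⟨x, rfl⟩ | ⟨x, rfl⟩)
    · exact key true x
    · exact key false x
  let qB := QuotientGroup.mk' B.range
  have hlift : ∀ b, ∀ x ∈ C, (qB.comp (o b)) x = 1 := by
    intro b x hx
    refine (QuotientGroup.eq_one_iff _).2 ?_
    exact ⟨⟨x, hx⟩, (hoB b ⟨x, hx⟩).symm⟩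
  let back : Monoid.Coprod (A ⧸ C) (A ⧸ C) →* (Monoid.PushoutI (fun _ : Bool => C.subtype)) ⧸ B.range := Monoid.Coprod.lift
    (QuotientGroup.lift C (qB.comp (o true)) (hlift true))
    (QuotientGroup.lift C (qB.comp (o false)) (hlift false))
  have hback : back.comp κ = qB := by
    refine MonoidHom.eq_of_eqOn_dense (dbl_closure C) ?_
    rintro _ (⟨x, rfl⟩ | ⟨x, rfl⟩)
    · rw [MonoidHom.comp_apply]
      exact (congrArg back (hκ1 x)).trans (by simp [back, mkC]; rfl)
    · rw [MonoidHom.comp_apply]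
      exact (congrArg back (hκ2 x)).trans (by simp [back, mkC]; rfl)
  have hker : ∀ g, κ g = 1 → ∃ c, B c = g := by
    intro g hg
    have h1 : qB g = 1 := by rw [← hback, MonoidHom.comp_apply, hg, map_one]
    exact (QuotientGroup.eq_one_iff _).1 h1
  -- the two homomorphisms
  let θ : FreeGroup (Fin m) →* A := FreeGroup.lift fun i => (a i)⁻¹
  let f₂ : (Monoid.PushoutI (fun _ : Bool => C.subtype)) ⋊[ρ] FreeGroup (Fin m) →* A := SemidirectProduct.lift fold θ
    (action_compat ρ fold θ _ (dbl_closure C) _ (FreeGroup.closure_range_of _) (by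
      have key : ∀ i b x, fold (ρ (FreeGroup.of i) (o b x)) =
          θ (FreeGroup.of i) * fold (o b x) * (θ (FreeGroup.of i))⁻¹ := by
        intro i b x
        rw [hfold]
        refine (congrArg fold (hρ i b x)).trans ((hfold b _).trans ?_)
        simp [θ]
      rintro _ ⟨i, rfl⟩ _ (⟨x, rfl⟩ | ⟨x, rfl⟩)
      · exact key i true x
      · exact key i false x))
  let f₁ : (Monoid.PushoutI (fun _ : Bool => C.subtype)) ⋊[ρ] FreeGroup (Fin m) →*
      (Monoid.Coprod (A ⧸ C) (A ⧸ C)) ⋊[σ] FreeGroup (Fin m) :=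
    SemidirectProduct.lift (SemidirectProduct.inl.comp κ) SemidirectProduct.inr
    (action_compat ρ _ _ _ (dbl_closure C) _ (FreeGroup.closure_range_of _) (by
      rintro _ ⟨i, rfl⟩ _ (⟨x, rfl⟩ | ⟨x, rfl⟩)
      · simp only [MonoidHom.comp_apply]
        rw [← map_inv, ← SemidirectProduct.inl_aut, hρ]
        refine congrArg _ ((hκ1 _).trans (Eq.trans ?_ (congrArg _ (hκ1 x)).symm))
        rw [hσl]
        rfl
      · simp only [MonoidHom.comp_apply]
        rw [← map_inv, ← SemidirectProduct.inl_aut, hρ]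
        refine congrArg _ ((hκ2 _).trans (Eq.trans ?_ (congrArg _ (hκ2 x)).symm))
        rw [hσr]
        rfl))
  refine ⟨f₁.prod f₂, (injective_iff_map_eq_one _).2 ?_⟩
  rintro ⟨g, k⟩ h
  rw [MonoidHom.prod_apply, Prod.mk_eq_one] at h
  obtain ⟨h1, h2⟩ := h
  rw [SemidirectProduct.mk_eq_inl_mul_inr] at h1 h2 ⊢
  simp only [f₁, f₂, map_mul, SemidirectProduct.lift_inl, SemidirectProduct.lift_inr,
    MonoidHom.comp_apply] at h1 h2
  have hk : k = 1 := by simpa using congrArg SemidirectProduct.right h1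
  subst hk
  have hg : κ g = 1 := by simpa using congrArg SemidirectProduct.left h1
  obtain ⟨c, rfl⟩ := hker g hg
  have hc : (c : A) = 1 := by
    rw [map_one, mul_one, ← hoB true, hfold] at h2
    exact h2
  have hc' : c = 1 := Subtype.ext hc
  rw [hc']; simp

end main

/-- Theorem 7: Let `C` be a normal subgroup of the finitely presented group `A`
which is the normal closure of a finite subset of `A`. Let `a₁, …, a_m ∈ A` have images
generating `A/C`, let `F_m` be the free group on `t₁, …, t_m`, and let `F_m` act on the double
`G = {A * Ā ; C = C̄}` (formalized as the pushout of two copies of `C ↪ A`) with `tᵢ` acting on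
each copy of `A` as conjugation by (the copy of) `aᵢ`. Then `E = G ⋊ F_m` is finitely
presented, and `E` embeds in the finitely presented group
`D = ((A/C * Ā/C̄) ⋊ F_m) × A`, where `tᵢ` acts on each free factor `A/C` as conjugation by
the image of `aᵢ`. -/
theorem split_extension_of_double_finitely_presented_and_embeds
    (A : Type*) [Group A] (C : Subgroup A) [C.Normal]
    (hA : IsFinitelyPresentedGroup A)
    (hC : ∃ S : Finset A, Subgroup.normalClosure (S : Set A) = C)
    (m : ℕ) (a : Fin m → A)
    (ha : Subgroup.closure (Set.range fun i => (QuotientGroup.mk (a i) : A ⧸ C)) = ⊤)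
    -- the action of `F_m` on the double `G`: `tᵢ` acts on each copy of `A` by conjugation
    -- by the corresponding copy of `aᵢ`
    (ρ : FreeGroup (Fin m) →* MulAut (Monoid.PushoutI (fun _ : Bool => C.subtype)))
    (hρ : ∀ (i : Fin m) (b : Bool) (x : A),
      ρ (FreeGroup.of i) (Monoid.PushoutI.of (φ := fun _ : Bool => C.subtype) b x) =
        Monoid.PushoutI.of (φ := fun _ : Bool => C.subtype) b ((a i)⁻¹ * x * a i))
    -- the action of `F_m` on `A/C * A/C`: `tᵢ` acts on each free factor by conjugation by
    -- the image of `aᵢ`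
    (σ : FreeGroup (Fin m) →* MulAut (Monoid.Coprod (A ⧸ C) (A ⧸ C)))
    (hσl : ∀ (i : Fin m) (q : A ⧸ C), σ (FreeGroup.of i) (Monoid.Coprod.inl q) =
      Monoid.Coprod.inl ((QuotientGroup.mk (a i) : A ⧸ C)⁻¹ * q * QuotientGroup.mk (a i)))
    (hσr : ∀ (i : Fin m) (q : A ⧸ C), σ (FreeGroup.of i) (Monoid.Coprod.inr q) =
      Monoid.Coprod.inr ((QuotientGroup.mk (a i) : A ⧸ C)⁻¹ * q * QuotientGroup.mk (a i))) :
    IsFinitelyPresentedGroup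
      ((Monoid.PushoutI (fun _ : Bool => C.subtype)) ⋊[ρ] FreeGroup (Fin m)) ∧
    IsFinitelyPresentedGroup
      (((Monoid.Coprod (A ⧸ C) (A ⧸ C)) ⋊[σ] FreeGroup (Fin m)) × A) ∧
    ∃ f : ((Monoid.PushoutI (fun _ : Bool => C.subtype)) ⋊[ρ] FreeGroup (Fin m)) →*
        ((Monoid.Coprod (A ⧸ C) (A ⧸ C)) ⋊[σ] FreeGroup (Fin m)) × A,
      Function.Injective f := by
  have := (isFinitelyPresentedGroup_iff A).1 hA
  refine ⟨?_, ?_, embeds_E C a ρ hρ σ hσl hσr⟩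
  · rw [isFinitelyPresentedGroup_iff]
    exact fp_E C a hC ha ρ hρ
  · rw [isFinitelyPresentedGroup_iff]
    obtain ⟨S, hS⟩ := hC
    have : Group.IsFinitelyPresented (A ⧸ C) :=
      Group.IsFinitelyPresented.quotient C ⟨S, S.finite_toSet, hS⟩
    have := fp_semidirect σ
    exact fp_prod
end
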